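/- For every f ∈ L¹(ℍⁿ) and every fixed z ∈ ℂⁿ, the function a ↦ f̃(a,z) is uniformly continuous on the Heisenberg fan Ω, where Ω carries the metric induced from the Euclidean metric on ℝ². -/

import Mathlib

open MeasureTheory Complex Real Filter

noncomputable section

/-- ℂⁿ with its Euclidean (Hilbert space) structure. -/
abbrev Cn (n : ℕ) := EuclideanSpace ℂ (Fin n)

instance (n : ℕ) : MeasurableSpace (Cn n) := borel _
instance (n : ℕ) : BorelSpace (Cn n) := ⟨rfl⟩
instance (n : ℕ) : InnerProductSpace ℝ (Cn n) := InnerProductSpace.rclikeToReal ℂ (Cn n)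

/-- The Heisenberg group ℍⁿ = ℂⁿ × ℝ (as a measure space with Lebesgue/Haar measure). -/
abbrev Hn (n : ℕ) := Cn n × ℝ

/-- Im (z · w̄) = Im (∑ⱼ zⱼ conj wⱼ). -/
def imZW {n : ℕ} (z w : Cn n) : ℝ := (∑ j, z j * (starRingEnd ℂ) (w j)).im

/-- The λ-twisted convolution F ∗_λ G (z) = ∫ F(z−w) G(w) e^{(i/2)λ Im(z·w̄)} dw. -/
def twConv (n : ℕ) (lam : ℝ) (F G : Cn n → ℂ) (z : Cn n) : ℂ :=
  ∫ w : Cn n, F (z - w) * G w * Complex.exp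
    (Complex.I / 2 * (lam : ℂ) * ((imZW z w : ℝ) : ℂ))

/-- The inverse Fourier transform in the central variable, f^λ(z) = ∫ e^{iλt} f(z,t) dt. -/
def fLam (n : ℕ) (f : Hn n → ℂ) (lam : ℝ) (z : Cn n) : ℂ :=
  ∫ t : ℝ, Complex.exp (Complex.I * (lam : ℂ) * (t : ℂ)) * f (z, t)

/-- The Laguerre polynomial of type m−1:
L_k^{m−1}(t) = ∑_{j=0}^k binom(k+m−1, k−j) (−t)^j / j!. -/
def lagPoly (m k : ℕ) (t : ℝ) : ℝ :=
  ∑ j ∈ Finset.range (k + 1), ((k + m - 1).choose (k - j) : ℝ) * (-t) ^ j / (Nat.factorial j)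

/-- The Laguerre function φ_{k,λ}^{m−1}(z) = L_k^{m−1}(|λ||z|²/2) e^{−|λ||z|²/4} on ℂ^m. -/
def lagFun (m k : ℕ) (lam : ℝ) (z : Cn m) : ℝ :=
  lagPoly m k (|lam| * ‖z‖ ^ 2 / 2) * Real.exp (-(|lam| * ‖z‖ ^ 2 / 4))

/-- The Strichartz Fourier transform f̂(a,z) = f^{−λ} ∗_{−λ} φ_{k,λ}(z)
at the point a = (λ, (2k+n)|λ|) of the ray R_k. -/
def stri (n : ℕ) (f : Hn n → ℂ) (k : ℕ) (lam : ℝ) (z : Cn n) : ℂ :=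
  twConv n (-lam) (fLam n f (-lam)) (fun w => ((lagFun n k lam w : ℝ) : ℂ)) z

/-- The normalizing constant k!(n−1)!/(k+n−1)!. -/
def normC (n k : ℕ) : ℝ :=
  (Nat.factorial k * Nat.factorial (n - 1) : ℝ) / (Nat.factorial (k + n - 1))

/-- The Bessel kernel J_{n−1}(s)/s^{n−1}, extended by its limiting value
1/(2^{n−1}(n−1)!) at s = 0, given by its power series. -/
def besselKer (n : ℕ) (s : ℝ) : ℝ :=
  ∑' m : ℕ, (-1 : ℝ) ^ m / (Nat.factorial m * Nat.factorial (m + n - 1)) *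
    s ^ (2 * m) / 2 ^ (2 * m + n - 1)

/-- The Strichartz Fourier transform f̂((0,τ),z) on the limiting ray R_∞. -/
def striLim (n : ℕ) (f : Hn n → ℂ) (z : Cn n) (τ : ℝ) : ℂ :=
  ((Nat.factorial (n - 1) * 2 ^ (n - 1) : ℝ) : ℂ) *
    ∫ w : Cn n, fLam n f 0 (z - w) * ((besselKer n (Real.sqrt τ * ‖w‖) : ℝ) : ℂ)

/-- The Heisenberg fan Ω ⊆ ℝ²: union of the rays R_k, k ∈ ℕ, and the limiting ray R_∞. -/
def fan (n : ℕ) : Set (ℝ × ℝ) :=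
  {a | (∃ k : ℕ, a.1 ≠ 0 ∧ a.2 = (2 * k + n) * |a.1|) ∨ (a.1 = 0 ∧ 0 ≤ a.2)}

open scoped Classical in
/-- The index k of the ray R_k through a point of the fan (junk value otherwise). -/
def fanK (n : ℕ) (a : ℝ × ℝ) : ℕ :=
  if h : ∃ k : ℕ, a.2 = (2 * k + n) * |a.1| then h.choose else 0

/-- The normalized Strichartz Fourier transform f̃(a,z), as a function of a ∈ Ω. -/
def striNorm (n : ℕ) (f : Hn n → ℂ) (z : Cn n) (a : ℝ × ℝ) : ℂ :=
  if a.1 = 0 then striLim n f z a.2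
  else ((normC n (fanK n a) : ℝ) : ℂ) * stri n f (fanK n a) a.1 z

/-- The Plancherel measure ν on the Heisenberg fan:
∫ φ dν = (2π)^{−2n−1} ∫_ℝ (∑_k φ(λ,(2k+n)|λ|)) |λ|^{2n} dλ. -/
def fanMeasure (n : ℕ) : Measure (ℝ × ℝ) :=
  (ENNReal.ofReal ((2 * π) ^ (2 * n + 1)))⁻¹ •
    Measure.sum (fun k : ℕ =>
      Measure.map (fun lam : ℝ => (lam, (2 * k + n) * |lam|))
        (volume.withDensity fun lam => ENNReal.ofReal (|lam| ^ (2 * n))))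

/-- A function on ℍⁿ is radial if it is invariant under the action of the unitary group U(n). -/
def IsRadial (n : ℕ) (g : Hn n → ℂ) : Prop :=
  ∀ (U : Cn n ≃ₗᵢ[ℂ] Cn n) (x : Hn n), g (U x.1, x.2) = g x

/-- The k-th Laguerre coefficient R_k(λ, f) = (k!(n−1)!/(k+n−1)!) ∫ f^λ(w) φ_{k,λ}(w) dw. -/
def lagCoef (n : ℕ) (k : ℕ) (lam : ℝ) (f : Hn n → ℂ) : ℂ :=
  ((normC n k : ℝ) : ℂ) * ∫ w : Cn n, fLam n f lam w * ((lagFun n k lam w : ℝ) : ℂ)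

/-- The Gelfand (spherical Fourier) transform of a radial function on ℍ^m, evaluated at
(λ, (2j+m)|λ|). -/
def gelfand (m : ℕ) (h : Hn m → ℂ) (lam : ℝ) (j : ℕ) : ℂ :=
  ((normC m j : ℝ) : ℂ) *
    ∫ x : Hn m, h x * Complex.exp (Complex.I * (lam : ℂ) * (x.2 : ℂ)) *
      ((lagFun m j lam x.1 : ℝ) : ℂ)

/-- The group convolution on ℍⁿ: f∗g(x) = ∫ f(x·y⁻¹) g(y) dy. -/
def hConv (n : ℕ) (f g : Hn n → ℂ) (x : Hn n) : ℂ :=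
  ∫ y : Hn n, f (x.1 - y.1, x.2 - y.2 - imZW x.1 y.1 / 2) * g y

/-- P is a bigraded solid harmonic of degree (p,q) on ℂⁿ: P(z) = ∑_{|α|=p,|β|=q} c_{αβ} z^α z̄^β,
harmonic as a function on ℝ^{2n} (the harmonicity Δ P = 0 is expressed by the equivalent
algebraic condition on the coefficients). -/
def IsBigradedSolidHarmonic (n p q : ℕ) (P : Cn n → ℂ) : Prop :=
  ∃ c : (Fin n → ℕ) → (Fin n → ℕ) → ℂ,
    (∀ z : Cn n, P z =
      ∑ α ∈ Finset.Nat.antidiagonalTuple n p, ∑ β ∈ Finset.Nat.antidiagonalTuple n q,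
        c α β * (∏ j, z j ^ α j) * ∏ j, (starRingEnd ℂ) (z j) ^ β j) ∧
    (∀ γ δ : Fin n → ℕ,
      ∑ j : Fin n, (((γ j + 1) * (δ j + 1) : ℕ) : ℂ) *
        c (Function.update γ j (γ j + 1)) (Function.update δ j (δ j + 1)) = 0)

/-- The physicists' Hermite polynomial H_m(x) = (−1)^m e^{x²} (d/dx)^m e^{−x²}. -/
def physHermite (m : ℕ) (x : ℝ) : ℝ :=
  (-1 : ℝ) ^ m * Real.exp (x ^ 2) * iteratedDeriv m (fun y => Real.exp (-(y ^ 2))) x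

/-- The normalized Hermite function h_m(x) = (2^m m! √π)^{−1/2} H_m(x) e^{−x²/2}. -/
def hermiteFun (m : ℕ) (x : ℝ) : ℝ :=
  (Real.sqrt (2 ^ m * (Nat.factorial m) * Real.sqrt π))⁻¹ * physHermite m x *
    Real.exp (-(x ^ 2) / 2)

/-- The scaled Hermite function Φ_α^λ(x) = |λ|^{n/4} ∏ⱼ h_{αⱼ}(√|λ| xⱼ). -/
def scaledHermite (n : ℕ) (lam : ℝ) (α : Fin n → ℕ) (x : Fin n → ℝ) : ℝ :=
  |lam| ^ ((n : ℝ) / 4) * ∏ j, hermiteFun (α j) (Real.sqrt |lam| * x j)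

/-- The Schrödinger representation: π_λ(z,t)φ(ξ) = e^{iλt} e^{iλ(x·ξ+(1/2)x·y)} φ(ξ+y),
z = x+iy. -/
def schrodinger (n : ℕ) (lam : ℝ) (zt : Hn n) (φ : (Fin n → ℝ) → ℂ) (ξ : Fin n → ℝ) : ℂ :=
  Complex.exp (Complex.I * (lam : ℂ) * (zt.2 : ℂ)) *
    Complex.exp (Complex.I * (lam : ℂ) *
      (((∑ j, (zt.1 j).re * ξ j) + (∑ j, (zt.1 j).re * (zt.1 j).im) / 2 : ℝ) : ℂ)) *
    φ (fun j => ξ j + (zt.1 j).im)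

/-- The group Fourier transform f̂(λ)φ = ∫ f(z,t) π_λ(z,t)φ dz dt. -/
def groupFT (n : ℕ) (f : Hn n → ℂ) (lam : ℝ) (φ : (Fin n → ℝ) → ℂ) (ξ : Fin n → ℝ) : ℂ :=
  ∫ x : Hn n, f x * schrodinger n lam x φ ξ

/-- The coefficients of `(X - a)ᵏ e^{aX}`. -/
def fockCoeff (a : ℝ) (k m : ℕ) : ℝ :=
  PowerSeries.coeff m
    ((PowerSeries.X - PowerSeries.C a) ^ k * PowerSeries.rescale a (PowerSeries.exp ℝ))

lemma fockCoeff_zero_left (a : ℝ) (m : ℕ) : fockCoeff a 0 m = a ^ m / m.factorial := by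
  simp [fockCoeff, PowerSeries.coeff_rescale, PowerSeries.coeff_exp, div_eq_mul_inv]

lemma fockCoeff_succ_zero (a : ℝ) (k : ℕ) :
    fockCoeff a (k + 1) 0 = -a * fockCoeff a k 0 := by
  simp only [fockCoeff, pow_succ', mul_assoc, sub_mul, map_sub, PowerSeries.coeff_zero_X_mul,
    PowerSeries.coeff_C_mul]
  ring

lemma fockCoeff_succ_succ (a : ℝ) (k m : ℕ) :
    fockCoeff a (k + 1) (m + 1) = fockCoeff a k m - a * fockCoeff a k (m + 1) := by
  simp only [fockCoeff, pow_succ', mul_assoc, sub_mul, map_sub, PowerSeries.coeff_succ_X_mul,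
    PowerSeries.coeff_C_mul]

lemma fockCoeff_derivative (a : ℝ) (k m : ℕ) :
    (m + 1) * fockCoeff a (k + 1) (m + 1) =
      (k + 1) * fockCoeff a k m + a * fockCoeff a (k + 1) m := by
  induction k generalizing m with
  | zero =>
    have h0 : fockCoeff a 0 (m + 1) * (m + 1) = a * fockCoeff a 0 m := by
      rw [fockCoeff_zero_left, fockCoeff_zero_left, Nat.factorial_succ]
      push_cast
      field_simp
      ring
    rw [fockCoeff_succ_succ]
    cases m with
    | zero =>
      rw [fockCoeff_succ_zero]
      push_cast at *
      linear_combination (-a) * h0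
    | succ m =>
      have h1 : fockCoeff a 0 (m + 1) * (m + 1) = a * fockCoeff a 0 m := by
        rw [fockCoeff_zero_left, fockCoeff_zero_left, Nat.factorial_succ]
        push_cast
        field_simp
        ring
      rw [fockCoeff_succ_succ]
      push_cast at *
      linear_combination (-a) * h0 + h1
  | succ k ih =>
    rw [fockCoeff_succ_succ a (k + 1)]
    cases m with
    | zero =>
      rw [fockCoeff_succ_zero a (k + 1)]
      have := ih 0
      push_cast at *
      linear_combination (-a) * this - (k + 1) * fockCoeff_succ_zero a k
    | succ m =>
      rw [fockCoeff_succ_succ a (k + 1)]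
      have h1 := ih (m + 1)
      have h2 := ih m
      have h3 := fockCoeff_succ_succ a k m
      push_cast at *
      linear_combination (-a) * h1 + h2 - (k + 1) * h3

lemma exists_abs_fockCoeff_le (a : ℝ) (k : ℕ) :
    ∃ C B : ℝ, 0 ≤ C ∧ 0 ≤ B ∧ ∀ m, |fockCoeff a k m| ≤ C * B ^ m / m.factorial := by
  induction k with
  | zero =>
    refine ⟨1, |a|, zero_le_one, abs_nonneg a, fun m => ?_⟩
    rw [fockCoeff_zero_left, abs_div, abs_pow, one_mul, Nat.abs_cast]
  | succ k ih =>
    obtain ⟨C, B, hC, hB, h⟩ := ih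
    refine ⟨C * (1 + |a|), 2 * (B + 1), by positivity, by positivity, fun m => ?_⟩
    cases m with
    | zero =>
      rw [fockCoeff_succ_zero, abs_mul, abs_neg]
      have := h 0
      simp only [pow_zero, Nat.factorial_zero, Nat.cast_one, mul_one, div_one] at *
      nlinarith [abs_nonneg a]
    | succ m =>
      rw [fockCoeff_succ_succ]
      have hfac : (0 : ℝ) < ((m + 1).factorial : ℝ) := by positivity
      have hBm : B ^ m ≤ (B + 1) ^ (m + 1) := by
        calc B ^ m ≤ (B + 1) ^ m := by gcongr; linarith
          _ ≤ (B + 1) ^ (m + 1) := by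
            apply pow_le_pow_right₀ <;> [linarith; omega]
      have hm2 : ((m : ℝ) + 1) ≤ 2 ^ (m + 1) := by
        exact_mod_cast (Nat.lt_two_pow_self (n := m + 1)).le
      have e1 : |fockCoeff a k m| ≤ C * (2 * (B + 1)) ^ (m + 1) / (m + 1).factorial := by
        refine (h m).trans ?_
        rw [div_le_div_iff₀ (by positivity) hfac, Nat.factorial_succ, mul_pow]
        push_cast
        have : ((m : ℝ) + 1) * B ^ m ≤ 2 ^ (m + 1) * (B + 1) ^ (m + 1) := by gcongr
        have h2 : (0 : ℝ) ≤ C * m.factorial := by positivity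
        nlinarith [mul_le_mul_of_nonneg_left this h2]
      have e2 : |fockCoeff a k (m + 1)| ≤ C * (2 * (B + 1)) ^ (m + 1) / (m + 1).factorial := by
        refine (h (m + 1)).trans ?_
        gcongr
        linarith
      calc |fockCoeff a k m - a * fockCoeff a k (m + 1)|
          ≤ |fockCoeff a k m| + |a| * |fockCoeff a k (m + 1)| := by
            rw [← abs_mul]; exact abs_sub _ _
        _ ≤ C * (2 * (B + 1)) ^ (m + 1) / (m + 1).factorial +
            |a| * (C * (2 * (B + 1)) ^ (m + 1) / (m + 1).factorial) := by gcongr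
        _ = _ := by ring

lemma summable_factorial_mul_fockCoeff (a : ℝ) (k l : ℕ) :
    Summable fun m : ℕ => (m.factorial : ℝ) * fockCoeff a k m * fockCoeff a l m := by
  obtain ⟨C, B, hC, hB, h⟩ := exists_abs_fockCoeff_le a k
  obtain ⟨C', B', hC', hB', h'⟩ := exists_abs_fockCoeff_le a l
  refine Summable.of_norm_bounded
    (((Real.summable_pow_div_factorial (B * B')).mul_left (C * C'))) fun m => ?_
  have hfac : (0 : ℝ) < (m.factorial : ℝ) := by positivity
  rw [Real.norm_eq_abs, abs_mul, abs_mul, Nat.abs_cast]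
  calc (m.factorial : ℝ) * |fockCoeff a k m| * |fockCoeff a l m|
      ≤ m.factorial * (C * B ^ m / m.factorial) * (C' * B' ^ m / m.factorial) := by
        gcongr
        · exact h m
        · exact h' m
    _ = _ := by rw [mul_pow]; field_simp

lemma tsum_factorial_mul_fockCoeff_sq (a : ℝ) (k : ℕ) :
    ∑' m : ℕ, (m.factorial : ℝ) * fockCoeff a k m * fockCoeff a k m =
      k.factorial * Real.exp (a ^ 2) := by
  induction k with
  | zero =>
    rw [Real.exp_eq_exp_ℝ, NormedSpace.exp_eq_tsum_div]
    simp only [Nat.factorial_zero, Nat.cast_one, one_mul]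
    refine tsum_congr fun m => ?_
    have hfac : (0 : ℝ) < (m.factorial : ℝ) := by positivity
    rw [fockCoeff_zero_left, ← pow_mul, mul_comm 2 m, pow_mul]
    field_simp
  | succ k ih =>
    have s1 := summable_factorial_mul_fockCoeff a (k + 1) (k + 1)
    have s2 := summable_factorial_mul_fockCoeff a k (k + 1)
    have s3 := summable_factorial_mul_fockCoeff a k k
    have s4 : Summable fun m : ℕ =>
        ((m + 1).factorial : ℝ) * fockCoeff a k m * fockCoeff a (k + 1) (m + 1) := by
      refine ((s3.mul_left ((k : ℝ) + 1)).add (s2.mul_left a)).congr fun m => ?_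
      have := fockCoeff_derivative a k m
      rw [Nat.factorial_succ]
      push_cast
      linear_combination (-(m.factorial : ℝ) * fockCoeff a k m) * this
    have e4 : ∑' m : ℕ, ((m + 1).factorial : ℝ) * fockCoeff a k m * fockCoeff a (k + 1) (m + 1) =
        (k + 1) * ∑' m : ℕ, (m.factorial : ℝ) * fockCoeff a k m * fockCoeff a k m +
        a * ∑' m : ℕ, (m.factorial : ℝ) * fockCoeff a k m * fockCoeff a (k + 1) m := by
      rw [← tsum_mul_left, ← tsum_mul_left,
        ← (s3.mul_left ((k : ℝ) + 1)).tsum_add (s2.mul_left a)]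
      refine tsum_congr fun m => ?_
      have := fockCoeff_derivative a k m
      rw [Nat.factorial_succ]
      push_cast
      linear_combination ((m.factorial : ℝ) * fockCoeff a k m) * this
    have s2' := (summable_nat_add_iff 1).2 s2
    rw [s1.tsum_eq_zero_add]
    have e5 : ∑' m : ℕ, ((m + 1).factorial : ℝ) * fockCoeff a (k + 1) (m + 1) *
        fockCoeff a (k + 1) (m + 1) =
        ∑' m : ℕ, ((m + 1).factorial : ℝ) * fockCoeff a k m * fockCoeff a (k + 1) (m + 1) -
        a * ∑' m : ℕ, ((m + 1).factorial : ℝ) * fockCoeff a k (m + 1) *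
          fockCoeff a (k + 1) (m + 1) := by
      rw [← tsum_mul_left, ← s4.tsum_sub (s2'.mul_left a)]
      refine tsum_congr fun m => ?_
      have := fockCoeff_succ_succ a k m
      linear_combination (((m + 1).factorial : ℝ) * fockCoeff a (k + 1) (m + 1)) * this
    have e6 := s2.tsum_eq_zero_add
    have e7 := fockCoeff_succ_zero a k
    rw [Nat.factorial_succ]
    push_cast
    simp only [Nat.factorial_zero, Nat.cast_one, one_mul] at *
    linear_combination e5 + e4 + a * e6 + (k + 1) * ih + fockCoeff a (k + 1) 0 * e7

lemma fockCoeff_self (a : ℝ) (k : ℕ) : fockCoeff a k k = lagPoly 1 k (a ^ 2) := by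
  have hP : ((PowerSeries.X - PowerSeries.C a) ^ k : PowerSeries ℝ) =
      (((Polynomial.X + Polynomial.C (-a)) ^ k : Polynomial ℝ) : PowerSeries ℝ) := by
    simp [sub_eq_add_neg]
  rw [fockCoeff, hP, PowerSeries.coeff_mul, Finset.Nat.sum_antidiagonal_eq_sum_range_succ_mk,
    lagPoly, ← Finset.sum_range_reflect]
  refine Finset.sum_congr rfl fun j hj => ?_
  have hjk : j ≤ k := Nat.lt_succ_iff.1 (Finset.mem_range.1 hj)
  simp only [Polynomial.coeff_coe, Polynomial.coeff_X_add_C_pow, PowerSeries.coeff_rescale,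
    PowerSeries.coeff_exp, Nat.add_sub_cancel, Nat.succ_eq_add_one]
  rw [show k - (k - j) = j by omega, neg_pow a, neg_pow (a ^ 2)]
  simp only [map_div₀, map_one, map_natCast]
  ring

/-- The classical bound for the Laguerre polynomials of type zero on the half line. -/
lemma abs_lagPoly_one_le (k : ℕ) {x : ℝ} (hx : 0 ≤ x) :
    |lagPoly 1 k x| ≤ Real.exp (x / 2) := by
  have h1 := (summable_factorial_mul_fockCoeff (√x) k k).le_tsum k fun m _ => by
    rw [mul_assoc]
    exact mul_nonneg (by positivity) (mul_self_nonneg _)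
  rw [tsum_factorial_mul_fockCoeff_sq, fockCoeff_self, Real.sq_sqrt hx, mul_assoc] at h1
  have h2 := le_of_mul_le_mul_left h1 (by positivity : (0 : ℝ) < k.factorial)
  have h3 : Real.exp x = Real.exp (x / 2) ^ 2 := by
    rw [← Real.exp_nat_mul]
    congr 1
    push_cast
    ring
  rw [h3, ← sq] at h2
  exact abs_le_of_sq_le_sq h2 (Real.exp_pos _).le

lemma lagPoly_succ_succ (m k : ℕ) (t : ℝ) :
    lagPoly (m + 2) (k + 1) t = lagPoly (m + 2) k t + lagPoly (m + 1) (k + 1) t := by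
  rw [lagPoly, lagPoly, lagPoly, Finset.sum_range_succ, Finset.sum_range_succ _ (k + 1),
    ← add_assoc (G := ℝ),
    ← Finset.sum_add_distrib]
  congr 1
  · refine Finset.sum_congr rfl fun j hj => ?_
    have hjk : j ≤ k := Nat.lt_succ_iff.1 (Finset.mem_range.1 hj)
    rw [show k + 1 + (m + 2) - 1 = (k + m + 1) + 1 by omega,
      show k + 1 - j = (k - j) + 1 by omega, Nat.choose_succ_succ,
      show k + (m + 2) - 1 = k + m + 1 by omega,
      show k + 1 + (m + 1) - 1 = k + m + 1 by omega]
    push_cast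
    ring
  · simp

lemma lagPoly_zero_right (m : ℕ) (t : ℝ) : lagPoly m 0 t = 1 := by
  simp [lagPoly]

lemma abs_lagPoly_le (m k : ℕ) {x : ℝ} (hx : 0 ≤ x) :
    |lagPoly (m + 1) k x| ≤ (k + m).choose k * Real.exp (x / 2) := by
  induction m generalizing k with
  | zero => simpa using abs_lagPoly_one_le k hx
  | succ m ihm =>
    induction k with
    | zero =>
      rw [lagPoly_zero_right]
      simp only [abs_one, Nat.choose_zero_right, Nat.cast_one, one_mul]
      exact Real.one_le_exp (by positivity)
    | succ k ihk =>
      rw [lagPoly_succ_succ]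
      refine (abs_add_le _ _).trans ((add_le_add ihk (ihm (k + 1))).trans_eq ?_)
      rw [← add_mul, show k + 1 + (m + 1) = (k + (m + 1)) + 1 by omega, Nat.choose_succ_succ,
        show k + 1 + m = k + (m + 1) by omega]
      push_cast
      ring

lemma normC_mul_choose (m k : ℕ) : normC (m + 1) k * (k + m).choose k = 1 := by
  have h := Nat.add_choose_mul_factorial_mul_factorial k m
  have h' : ((k + m).choose k : ℝ) * k.factorial * m.factorial = (k + m).factorial := by
    rw [Nat.choose_symm_add]
    exact_mod_cast h
  have : (0 : ℝ) < (k + m).factorial := by positivity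
  simp only [normC, Nat.add_sub_cancel, ← add_assoc]
  field_simp
  linarith

lemma abs_normC_mul_lagFun_le_one (m k : ℕ) (lam : ℝ) (w : Cn (m + 1)) :
    |normC (m + 1) k * lagFun (m + 1) k lam w| ≤ 1 := by
  have hC : 0 ≤ normC (m + 1) k := by unfold normC; positivity
  have h := abs_lagPoly_le m k (x := |lam| * ‖w‖ ^ 2 / 2) (by positivity)
  rw [lagFun, abs_mul, abs_mul, abs_of_nonneg hC, Real.abs_exp]
  calc _ ≤ normC (m + 1) k * (((k + m).choose k * Real.exp (|lam| * ‖w‖ ^ 2 / 2 / 2)) *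
        Real.exp (-(|lam| * ‖w‖ ^ 2 / 4))) := by gcongr
    _ = (normC (m + 1) k * (k + m).choose k) *
        (Real.exp (|lam| * ‖w‖ ^ 2 / 2 / 2) * Real.exp (-(|lam| * ‖w‖ ^ 2 / 4))) := by ring
    _ = 1 := by
      rw [normC_mul_choose, ← Real.exp_add, one_mul]
      ring_nf
      exact Real.exp_zero

/-- Energy estimate for the normalized Laguerre equation `s y₂ + n y₁ + (K - s / 4) y = 0`, where
`y₁` and `y₂` are the first two derivatives of `y`. -/
lemma sqrt_mul_sq_le_of_laguerre_ode {n K : ℝ} (hn : 1 ≤ n) (hK : 0 < K) {y y₁ y₂ : ℝ → ℝ}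
    (hy : ∀ s, HasDerivAt y (y₁ s) s) (hy₁ : ∀ s, HasDerivAt y₁ (y₂ s) s)
    (ode : ∀ s, s * y₂ s + n * y₁ s + (K - s / 4) * y s = 0)
    (hy0 : y 0 = 1) (hb : ∀ s, 0 ≤ s → |y s| ≤ 1)
    {s : ℝ} (hs : 1 ≤ K * s) (hsK : s ≤ 2 * K) :
    √K * √s * y s ^ 2 ≤ 4 + n / 2 := by
  have hs0 : 0 < s := by
    by_contra! h
    nlinarith
  set H : ℝ → ℝ := fun s => (K - s / 4) * y s ^ 2 + s * y₁ s ^ 2 with hH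
  have hHd : ∀ s, HasDerivAt H (-(y s ^ 2) / 4 - (2 * n - 1) * y₁ s ^ 2) s := fun s => by
    have := ((((hasDerivAt_id s).div_const 4).const_sub K).mul ((hy s).pow 2)).add
      ((hasDerivAt_id s).mul ((hy₁ s).pow 2))
    refine this.congr_deriv ?_
    have := ode s
    simp only [id, Pi.pow_apply]
    push_cast
    linear_combination (2 * y₁ s) * this
  have hHanti : Antitone H := antitone_of_hasDerivAt_nonpos hHd fun s => by
    have : 0 ≤ (2 * n - 1) * y₁ s ^ 2 := mul_nonneg (by linarith) (sq_nonneg _)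
    have := sq_nonneg (y s)
    simp only [Pi.zero_apply]
    linarith
  have hHK : ∀ t, 0 ≤ t → H t ≤ K := fun t ht => by
    have := hHanti ht
    simpa [hH, hy0] using this
  have hder : ∀ t, 0 < t → t ≤ 2 * K → √t * |y₁ t| ≤ √K := fun t ht htK => by
    apply Real.le_sqrt_of_sq_le
    rw [mul_pow, Real.sq_sqrt ht.le, sq_abs]
    have := hHK t ht.le
    have h2 : 0 ≤ (K - t / 4) * y t ^ 2 := mul_nonneg (by linarith) (sq_nonneg _)
    simp only [hH] at this
    linarith
  have hcross : ∀ t, 0 < t → t ≤ 2 * K → |√t * y t * y₁ t| ≤ √K := fun t ht htK => by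
    rw [abs_mul, abs_mul, abs_of_nonneg (Real.sqrt_nonneg t)]
    have h1 := hder t ht htK
    have h2 := hb t ht.le
    have h3 : 0 ≤ √t * |y₁ t| := by positivity
    nlinarith [abs_nonneg (y t)]
  set G : ℝ → ℝ := fun s => √s * H s + 1 / 2 * (√s * y s * y₁ s) +
    (2 * n - 1) / 8 * (y s ^ 2 / √s) with hG
  have hGd : ∀ t, 0 < t → HasDerivAt G (-(2 * n - 2) * √t * y₁ t ^ 2 - √t / 4 * y t ^ 2 -
      (2 * n - 1) / (16 * √t ^ 3) * y t ^ 2) t := fun t ht => by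
    have hp : 0 < √t := Real.sqrt_pos.2 ht
    have hsq : HasDerivAt (fun x => √x) (1 / (2 * √t)) t := Real.hasDerivAt_sqrt ht.ne'
    have := ((hsq.mul (hHd t)).add (((hsq.mul (hy t)).mul (hy₁ t)).const_mul (1 / 2))).add
      ((((hy t).pow 2).div hsq hp.ne').const_mul ((2 * n - 1) / 8))
    refine this.congr_deriv ?_
    have ht2 : t = √t ^ 2 := (Real.sq_sqrt ht.le).symm
    have ho := ode t
    have hy2 : y₂ t = -(n * y₁ t + (K - t / 4) * y t) / t := by
      field_simp
      linarith
    simp only [hH, Pi.pow_apply, Pi.mul_apply]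
    rw [hy2]
    generalize √t = p at *
    subst ht2
    push_cast
    field_simp
    ring
  have hGanti : AntitoneOn G (Set.Ici (1 / K)) := by
    have hpos : ∀ t ∈ Set.Ici (1 / K), 0 < t := fun t ht => lt_of_lt_of_le (by positivity) ht
    refine antitoneOn_of_deriv_nonpos (convex_Ici _)
      (fun t ht => (hGd t (hpos t ht)).continuousAt.continuousWithinAt)
      (fun t ht => (hGd t (hpos t (interior_subset ht))).differentiableAt.differentiableWithinAt)
      fun t ht => ?_
    have ht0 := hpos t (interior_subset ht)
    rw [(hGd t ht0).deriv]
    have h1 : 0 ≤ (2 * n - 2) * √t * y₁ t ^ 2 :=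
      mul_nonneg (mul_nonneg (by linarith) (Real.sqrt_nonneg _)) (sq_nonneg _)
    have h2 : 0 ≤ √t / 4 * y t ^ 2 := by positivity
    have h3 : 0 ≤ (2 * n - 1) / (16 * √t ^ 3) * y t ^ 2 :=
      mul_nonneg (div_nonneg (by linarith) (by positivity)) (sq_nonneg _)
    linarith
  have hs1 : 1 / K ≤ s := by
    rw [div_le_iff₀ hK]
    linarith
  have hmono : G s ≤ G (1 / K) := hGanti (Set.mem_Ici.2 le_rfl) hs1 hs1
  have hp : 0 < √K := Real.sqrt_pos.2 hK
  have hKK : √K * √K = K := Real.mul_self_sqrt hK.le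
  have hs0pos : 0 < 1 / K := by positivity
  have hG0 : G (1 / K) ≤ (3 / 2 + (2 * n - 1) / 8) * √K := by
    have h1 : √(1 / K) * H (1 / K) ≤ √K := by
      calc √(1 / K) * H (1 / K) ≤ √(1 / K) * K := by gcongr; exact hHK _ hs0pos.le
        _ = √K := by
          rw [Real.sqrt_div zero_le_one, Real.sqrt_one]
          nth_rewrite 2 [← hKK]
          field_simp
    have h2 := (abs_le.1 (hcross (1 / K) hs0pos (hs1.trans hsK))).2
    have h3 : y (1 / K) ^ 2 / √(1 / K) ≤ √K := by
      rw [Real.sqrt_div zero_le_one, Real.sqrt_one, div_div_eq_mul_div, div_one]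
      have := hb (1 / K) hs0pos.le
      have : y (1 / K) ^ 2 ≤ 1 := by
        rw [← sq_abs]
        exact pow_le_one₀ (abs_nonneg _) this
      nlinarith
    have h4 : (2 * n - 1) / 8 * (y (1 / K) ^ 2 / √(1 / K)) ≤ (2 * n - 1) / 8 * √K :=
      mul_le_mul_of_nonneg_left h3 (by linarith)
    simp only [hG]
    linarith
  have hGs : √s * (K / 2 * y s ^ 2) - 1 / 2 * √K ≤ G s := by
    have h1 : √s * (K / 2 * y s ^ 2) ≤ √s * H s := by
      gcongr
      simp only [hH]
      have h1 : 0 ≤ (K / 2 - s / 4) * y s ^ 2 := mul_nonneg (by linarith) (sq_nonneg _)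
      have h2 : 0 ≤ s * y₁ s ^ 2 := by positivity
      linarith
    have h2 := (abs_le.1 (hcross s hs0 hsK)).1
    have h3 : 0 ≤ (2 * n - 1) / 8 * (y s ^ 2 / √s) :=
      mul_nonneg (by linarith) (by positivity)
    simp only [hG]
    linarith
  have hfin : √K * (√K * √s * y s ^ 2) ≤ √K * (4 + n / 2) := by
    have : √K * (√K * √s * y s ^ 2) = 2 * (√s * (K / 2 * y s ^ 2)) := by
      rw [← mul_assoc, ← mul_assoc, hKK]
      ring
    rw [this]
    nlinarith
  exact le_of_mul_le_mul_left hfin hp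

/-- The Laguerre polynomial of type `m - 1` as a formal polynomial. -/
def lagPolynomial (m k : ℕ) : Polynomial ℝ :=
  ∑ j ∈ Finset.range (k + 1),
    Polynomial.C (((k + m - 1).choose (k - j) : ℝ) * (-1) ^ j / j.factorial) * Polynomial.X ^ j

lemma eval_lagPolynomial (m k : ℕ) (t : ℝ) : (lagPolynomial m k).eval t = lagPoly m k t := by
  rw [lagPolynomial, Polynomial.eval_finsetSum, lagPoly]
  refine Finset.sum_congr rfl fun j _ => ?_
  rw [Polynomial.eval_mul, Polynomial.eval_C, Polynomial.eval_pow, Polynomial.eval_X, neg_pow t]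
  ring

lemma coeff_lagPolynomial (m k j : ℕ) : (lagPolynomial m k).coeff j =
    if j ≤ k then ((k + m - 1).choose (k - j) : ℝ) * (-1) ^ j / j.factorial else 0 := by
  simp [lagPolynomial, Polynomial.coeff_C_mul, Polynomial.coeff_X_pow]

lemma coeff_succ_lagPolynomial (m k j : ℕ) :
    (j + 1) * (j + (m + 1)) * (lagPolynomial (m + 1) k).coeff (j + 1) =
      (j - k) * (lagPolynomial (m + 1) k).coeff j := by
  rw [coeff_lagPolynomial, coeff_lagPolynomial]
  rcases lt_trichotomy j k with h | rfl | h
  · rw [if_pos (Nat.succ_le_of_lt h), if_pos h.le]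
    obtain ⟨r, rfl⟩ : ∃ r, k = j + 1 + r := ⟨k - (j + 1), by omega⟩
    have h1 := Nat.choose_succ_right_eq (j + 1 + r + m) r
    rw [show j + 1 + r + m - r = j + 1 + m by omega] at h1
    have h2 : ((j + 1 + r + m).choose (r + 1) : ℝ) * (r + 1) =
        (j + 1 + r + m).choose r * (j + 1 + m) := by exact_mod_cast h1
    rw [show j + 1 + r + (m + 1) - 1 = j + 1 + r + m by omega,
      show j + 1 + r - (j + 1) = r by omega, show j + 1 + r - j = r + 1 by omega,
      Nat.factorial_succ, pow_succ]
    push_cast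
    field_simp
    linear_combination h2
  · simp
  · rw [if_neg (by omega), if_neg (by omega)]
    simp

lemma lagPolynomial_ode (m k : ℕ) :
    Polynomial.X * (lagPolynomial (m + 1) k).derivative.derivative +
      (Polynomial.C ((m : ℝ) + 1) - Polynomial.X) * (lagPolynomial (m + 1) k).derivative +
      Polynomial.C (k : ℝ) * lagPolynomial (m + 1) k = 0 := by
  ext j
  have h := coeff_succ_lagPolynomial m k j
  cases j with
  | zero =>
    simp only [sub_mul, Polynomial.coeff_add, Polynomial.coeff_sub, Polynomial.coeff_X_mul_zero,
      Polynomial.coeff_C_mul, Polynomial.coeff_derivative, Polynomial.coeff_zero]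
    push_cast at *
    linear_combination h
  | succ j =>
    simp only [sub_mul, Polynomial.coeff_add, Polynomial.coeff_sub, Polynomial.coeff_X_mul,
      Polynomial.coeff_C_mul, Polynomial.coeff_derivative, Polynomial.coeff_zero]
    push_cast at *
    linear_combination h

lemma sqrt_mul_normC_mul_lagFun_sq_le (m k : ℕ) (lam : ℝ) (w : Cn (m + 1))
    (h1 : 1 ≤ (k + (m + 1) / 2 : ℝ) * (|lam| * ‖w‖ ^ 2 / 2))
    (h2 : |lam| * ‖w‖ ^ 2 / 2 ≤ 2 * (k + (m + 1) / 2 : ℝ)) :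
    √(k + (m + 1) / 2 : ℝ) * √(|lam| * ‖w‖ ^ 2 / 2) *
      (normC (m + 1) k * lagFun (m + 1) k lam w) ^ 2 ≤ 4 + (m + 1) / 2 := by
  set p := lagPolynomial (m + 1) k with hp
  set c := normC (m + 1) k with hc
  have hC : 0 ≤ c := by rw [hc]; unfold normC; positivity
  have he : ∀ s, HasDerivAt (fun s : ℝ => Real.exp (-(s / 2))) (-(1 / 2) * Real.exp (-(s / 2))) s :=
    fun s => by
      have := (((hasDerivAt_id s).div_const 2).neg).exp
      refine this.congr_deriv ?_
      simp only [id, Pi.neg_apply]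
      ring
  have hd : ∀ (q : Polynomial ℝ) s, HasDerivAt (fun s => c * (q.eval s * Real.exp (-(s / 2))))
      (c * ((q.derivative - Polynomial.C (1 / 2) * q).eval s * Real.exp (-(s / 2)))) s :=
    fun q s => by
      refine (((q.hasDerivAt s).mul (he s)).const_mul c).congr_deriv ?_
      simp only [Polynomial.eval_sub, Polynomial.eval_mul, Polynomial.eval_C]
      ring
  have key := sqrt_mul_sq_le_of_laguerre_ode (n := m + 1) (K := k + (m + 1) / 2)
    (by have : (0 : ℝ) ≤ m := by positivity
        linarith) (by positivity) (hd p) (hd _) (fun s => ?_) ?_ (fun s hs => ?_) h1 h2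
  · rw [eval_lagPolynomial] at key
    simpa only [lagFun, show |lam| * ‖w‖ ^ 2 / 2 / 2 = |lam| * ‖w‖ ^ 2 / 4 by ring] using key
  · have := congrArg (Polynomial.eval s) (lagPolynomial_ode m k)
    simp only [Polynomial.eval_sub, Polynomial.eval_add, Polynomial.eval_mul, Polynomial.eval_C,
      Polynomial.eval_X, Polynomial.eval_zero, Polynomial.derivative_sub, Polynomial.derivative_mul,
      Polynomial.derivative_C, ← hp, zero_mul, zero_add] at this ⊢
    linear_combination c * Real.exp (-(s / 2)) * this
  · rw [eval_lagPolynomial]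
    have h0 : lagPoly (m + 1) k 0 = (k + m).choose k := by
      rw [← eval_lagPolynomial, ← Polynomial.coeff_zero_eq_eval_zero, coeff_lagPolynomial]
      simp [← add_assoc]
    rw [h0, zero_div, neg_zero, Real.exp_zero, mul_one, normC_mul_choose]
  · rw [eval_lagPolynomial, abs_mul, abs_of_nonneg hC, abs_mul, Real.abs_exp]
    calc _ ≤ c * (((k + m).choose k * Real.exp (s / 2)) * Real.exp (-(s / 2))) := by
          gcongr; exact abs_lagPoly_le m k hs
      _ = (c * (k + m).choose k) * (Real.exp (s / 2) * Real.exp (-(s / 2))) := by ring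
      _ = 1 := by
        rw [normC_mul_choose, ← Real.exp_add, one_mul, add_neg_cancel, Real.exp_zero]

/-- The terms of the power series in `r` of `e^{|λ|r²/4}` times the spherical function attached to
the point `a = (λ, τ)`. -/
def fanTerm (m j : ℕ) (a : ℝ × ℝ) (r : ℝ) : ℝ :=
  (-1) ^ j * m.factorial / ((m + j).factorial * j.factorial) * (r ^ 2 / 4) ^ j *
    ∏ i ∈ Finset.range j, (a.2 - (m + 1 + 2 * i) * |a.1|)

/-- The entire interpolation in `a = (λ, τ)` of the normalized Laguerre functions and the
normalized Bessel kernel on `ℂ^{m+1}`, as a function of the radius. -/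
def fanKernel (m : ℕ) (a : ℝ × ℝ) (r : ℝ) : ℝ :=
  Real.exp (-(|a.1| * r ^ 2 / 4)) * ∑' j : ℕ, fanTerm m j a r

lemma abs_fanTerm_le (m j : ℕ) {a : ℝ × ℝ} {r M : ℝ} (h1 : |a.1| ≤ M) (h2 : |a.2| ≤ M)
    (hr : r ^ 2 / 4 ≤ M) : |fanTerm m j a r| ≤ (M * (M * (m + 4))) ^ j / j.factorial := by
  have hM : 0 ≤ M := (abs_nonneg _).trans h1
  have hprod : |∏ i ∈ Finset.range j, (a.2 - (m + 1 + 2 * i) * |a.1|)| ≤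
      (M * (m + 4)) ^ j * j.factorial := by
    rw [Finset.abs_prod]
    induction j with
    | zero => simp
    | succ j ih =>
      rw [Finset.prod_range_succ, pow_succ, Nat.factorial_succ]
      have : |a.2 - (m + 1 + 2 * j) * (|a.1|)| ≤ M * (m + 4) * (j + 1) := by
        calc |a.2 - (m + 1 + 2 * j) * (|a.1|)| ≤ |a.2| + |(m + 1 + 2 * j) * (|a.1|)| := abs_sub _ _
          _ = |a.2| + (m + 1 + 2 * j) * |a.1| := by
            rw [abs_mul, abs_abs, abs_of_nonneg (by positivity : (0 : ℝ) ≤ m + 1 + 2 * j)]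
          _ ≤ M + (m + 1 + 2 * j) * M := by gcongr
          _ ≤ M * (m + 4) * (j + 1) := by
            have : (0 : ℝ) ≤ M * (m * j + 2 * j + 2) := by positivity
            linarith
      calc _ ≤ (M * (m + 4)) ^ j * j.factorial * (M * (m + 4) * (j + 1)) := by gcongr
        _ = _ := by push_cast; ring
  have hfac : (m.factorial : ℝ) * j.factorial ≤ (m + j).factorial := by
    exact_mod_cast Nat.le_of_dvd (Nat.factorial_pos _)
      (Nat.factorial_mul_factorial_dvd_factorial_add m j)
  have hcoef : |(-1 : ℝ) ^ j * m.factorial / ((m + j).factorial * j.factorial)| ≤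
      1 / (j.factorial * j.factorial) := by
    rw [abs_div, abs_mul, abs_pow, abs_neg, abs_one, one_pow, one_mul, Nat.abs_cast, abs_mul,
      Nat.abs_cast, Nat.abs_cast, div_le_div_iff₀ (by positivity) (by positivity)]
    nlinarith [(Nat.cast_nonneg j.factorial : (0 : ℝ) ≤ j.factorial)]
  have hrj : |(r ^ 2 / 4) ^ j| ≤ M ^ j := by
    rw [abs_of_nonneg (by positivity)]
    gcongr
  rw [fanTerm, abs_mul, abs_mul]
  calc _ ≤ 1 / (j.factorial * j.factorial) * M ^ j * ((M * (m + 4)) ^ j * j.factorial) := by gcongr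
    _ = _ := by
      rw [mul_pow M (M * (m + 4))]
      field_simp

lemma continuous_fanTerm (m j : ℕ) :
    Continuous fun p : (ℝ × ℝ) × ℝ => fanTerm m j p.1 p.2 := by
  unfold fanTerm
  fun_prop

lemma continuous_fanKernel (m : ℕ) : Continuous fun p : (ℝ × ℝ) × ℝ => fanKernel m p.1 p.2 := by
  have : Continuous fun p : (ℝ × ℝ) × ℝ => ∑' j : ℕ, fanTerm m j p.1 p.2 := by
    rw [continuous_iff_continuousAt]
    intro p
    set M : ℝ := max (max |p.1.1| |p.1.2|) (p.2 ^ 2 / 4) + 1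
    have hU : {q : (ℝ × ℝ) × ℝ | |q.1.1| < M ∧ |q.1.2| < M ∧ q.2 ^ 2 / 4 < M} ∈ nhds p := by
      refine IsOpen.mem_nhds ?_ ⟨?_, ?_, ?_⟩
      · have e1 : Continuous fun q : (ℝ × ℝ) × ℝ => |q.1.1| := by fun_prop
        have e2 : Continuous fun q : (ℝ × ℝ) × ℝ => |q.1.2| := by fun_prop
        have e3 : Continuous fun q : (ℝ × ℝ) × ℝ => q.2 ^ 2 / 4 := by fun_prop
        exact (isOpen_lt e1 continuous_const).inter
          ((isOpen_lt e2 continuous_const).inter (isOpen_lt e3 continuous_const))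
      · exact lt_of_le_of_lt ((le_max_left _ _).trans (le_max_left _ _)) (lt_add_one _)
      · exact lt_of_le_of_lt ((le_max_right _ _).trans (le_max_left _ _)) (lt_add_one _)
      · exact lt_of_le_of_lt (le_max_right _ _) (lt_add_one _)
    refine ContinuousOn.continuousAt ?_ hU
    exact continuousOn_tsum (fun j => (continuous_fanTerm m j).continuousOn)
      (Real.summable_pow_div_factorial (M * (M * (m + 4))))
      fun j q hq => abs_fanTerm_le m j hq.1.le hq.2.1.le hq.2.2.le
  unfold fanKernel
  fun_prop

lemma fanKernel_eq_normC_mul_lagFun (m k : ℕ) {a : ℝ × ℝ}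
    (ha : a.2 = (2 * k + (m + 1)) * |a.1|) (w : Cn (m + 1)) :
    fanKernel m a ‖w‖ = normC (m + 1) k * lagFun (m + 1) k a.1 w := by
  have hfac : ∀ i : ℕ, a.2 - (m + 1 + 2 * i) * |a.1| = 2 * |a.1| * (k - i) := fun i => by
    rw [ha]
    ring
  have hprod : ∀ j, j ≤ k →
      (∏ i ∈ Finset.range j, ((k : ℝ) - i)) * (k - j).factorial = k.factorial := fun j hj => by
    induction j with
    | zero => simp
    | succ j ih =>
      rw [Finset.prod_range_succ, ← ih (by omega)]
      rw [show k - j = (k - (j + 1)) + 1 by omega, Nat.factorial_succ,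
        show k - (j + 1) + 1 = k - j by omega]
      push_cast [Nat.cast_sub (by omega : j ≤ k)]
      ring
  have hsum : ∑' j : ℕ, fanTerm m j a ‖w‖ =
      normC (m + 1) k * lagPoly (m + 1) k (|a.1| * ‖w‖ ^ 2 / 2) := by
    rw [tsum_eq_sum (s := Finset.range (k + 1)), lagPoly, Finset.mul_sum]
    · refine Finset.sum_congr rfl fun j hj => ?_
      have hjk : j ≤ k := Nat.lt_succ_iff.1 (Finset.mem_range.1 hj)
      have h1 := hprod j hjk
      have h2 := Nat.choose_mul_factorial_mul_factorial (show k - j ≤ k + m by omega)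
      rw [show k + m - (k - j) = m + j by omega] at h2
      have h2' : ((k + m).choose (k - j) : ℝ) * (k - j).factorial * (m + j).factorial =
          (k + m).factorial := by exact_mod_cast h2
      simp only [fanTerm, hfac, Finset.prod_mul_distrib, Finset.prod_const, Finset.card_range,
        normC, Nat.add_sub_cancel, ← add_assoc, neg_pow (|a.1| * ‖w‖ ^ 2 / 2)]
      rw [← h1, ← h2']
      have hc : ((k + m).choose (k - j) : ℝ) ≠ 0 := by
        exact_mod_cast (Nat.choose_pos (by omega)).ne'
      have hs : (‖w‖ ^ 2 / 4) ^ j * (2 * |a.1|) ^ j = (|a.1| * ‖w‖ ^ 2 / 2) ^ j := by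
        rw [← mul_pow]
        ring
      rw [← hs]
      rw [mul_pow 2]
      field_simp
    · intro j hj
      have hjk : k < j := by simpa using hj
      rw [fanTerm, Finset.prod_eq_zero (Finset.mem_range.2 hjk), mul_zero]
      rw [hfac, sub_self, mul_zero]
  rw [fanKernel, hsum, lagFun]
  ring

lemma fanKernel_zero_left (m : ℕ) {τ : ℝ} (hτ : 0 ≤ τ) (r : ℝ) :
    fanKernel m (0, τ) r = m.factorial * 2 ^ m * besselKer (m + 1) (√τ * r) := by
  rw [fanKernel, besselKer]
  simp only [abs_zero, zero_mul, zero_div, neg_zero, Real.exp_zero, one_mul]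
  rw [← tsum_mul_left]
  refine tsum_congr fun j => ?_
  simp only [fanTerm, abs_zero, mul_zero, sub_zero, Finset.prod_const, Finset.card_range]
  rw [show j + (m + 1) - 1 = m + j by omega, show 2 * j + (m + 1) - 1 = 2 * j + m by omega,
    pow_mul (√τ * r), mul_pow (√τ), Real.sq_sqrt hτ, pow_add, pow_mul, mul_pow, div_pow]
  norm_num
  field_simp

lemma exists_seq_ray_tendsto (m : ℕ) {τ : ℝ} (hτ : 0 ≤ τ) :
    ∃ u : ℕ → ℝ × ℝ, Tendsto u atTop (nhds (0, τ)) ∧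
      ∀ k, (u k).2 = τ ∧ (u k).2 = (2 * k + (m + 1)) * |(u k).1| := by
  refine ⟨fun k => (τ / (2 * k + (m + 1)), τ), ?_, fun k => ⟨rfl, ?_⟩⟩
  · rw [nhds_prod_eq]
    refine Tendsto.prodMk ?_ tendsto_const_nhds
    refine Tendsto.div_atTop tendsto_const_nhds ?_
    refine tendsto_atTop_add_const_right _ _ ?_
    exact tendsto_natCast_atTop_atTop.const_mul_atTop two_pos
  · have h : (0 : ℝ) < 2 * k + (m + 1) := by positivity
    simp only [abs_div, abs_of_nonneg hτ, abs_of_pos h]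
    field_simp

lemma mem_fan_succ {m : ℕ} {a : ℝ × ℝ} (ha : a ∈ fan (m + 1)) :
    (∃ k : ℕ, a.2 = (2 * k + (m + 1)) * |a.1|) ∨ (a.1 = 0 ∧ 0 ≤ a.2) := by
  rcases ha with ⟨k, -, h⟩ | h
  · exact Or.inl ⟨k, by simpa using h⟩
  · exact Or.inr h

lemma abs_fanKernel_le_one {m : ℕ} {a : ℝ × ℝ} (ha : a ∈ fan (m + 1)) (w : Cn (m + 1)) :
    |fanKernel m a ‖w‖| ≤ 1 := by
  have key : ∀ b : ℝ × ℝ, ∀ k : ℕ, b.2 = (2 * k + (m + 1)) * |b.1| → |fanKernel m b ‖w‖| ≤ 1 :=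
    fun b k hb => by
      rw [fanKernel_eq_normC_mul_lagFun m k hb]
      exact abs_normC_mul_lagFun_le_one m k b.1 w
  rcases mem_fan_succ ha with ⟨k, hk⟩ | ⟨h0, hτ⟩
  · exact key a k hk
  · obtain ⟨u, hu, hray⟩ := exists_seq_ray_tendsto m hτ
    have hc : Continuous fun b : ℝ × ℝ => |fanKernel m b ‖w‖| :=
      ((continuous_fanKernel m).comp (by fun_prop : Continuous fun b : ℝ × ℝ => (b, ‖w‖))).abs
    have ha' : a = (0, a.2) := Prod.ext h0 rfl
    rw [ha']
    exact le_of_tendsto' ((hc.tendsto _).comp hu) fun k => key _ k (hray k).2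

lemma sqrt_mul_fanKernel_sq_le {m : ℕ} {a : ℝ × ℝ} (ha : a ∈ fan (m + 1)) (w : Cn (m + 1))
    (h1 : 4 ≤ a.2 * ‖w‖ ^ 2) (h2 : a.1 ^ 2 * ‖w‖ ^ 2 < 2 * a.2) :
    √(a.2 * ‖w‖ ^ 2 / 4) * fanKernel m a ‖w‖ ^ 2 ≤ 4 + (m + 1) / 2 := by
  have key : ∀ b : ℝ × ℝ, ∀ k : ℕ, b.2 = (2 * k + (m + 1)) * |b.1| → 4 ≤ b.2 * ‖w‖ ^ 2 →
      b.1 ^ 2 * ‖w‖ ^ 2 < 2 * b.2 →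
      √(b.2 * ‖w‖ ^ 2 / 4) * fanKernel m b ‖w‖ ^ 2 ≤ 4 + (m + 1) / 2 := fun b k hb h1 h2 => by
    rw [fanKernel_eq_normC_mul_lagFun m k hb]
    have e : b.2 * ‖w‖ ^ 2 / 4 = (k + (m + 1) / 2 : ℝ) * (|b.1| * ‖w‖ ^ 2 / 2) := by
      rw [hb]
      ring
    rw [e, Real.sqrt_mul (by positivity)]
    refine sqrt_mul_normC_mul_lagFun_sq_le m k b.1 w (by linarith) ?_
    have hpos : 0 < |b.1| := by
      rw [abs_pos]
      intro h
      rw [h, abs_zero, mul_zero] at hb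
      rw [hb] at h1
      linarith
    refine le_of_mul_le_mul_left ?_ hpos
    rw [← sq_abs, hb] at h2
    nlinarith
  rcases mem_fan_succ ha with ⟨k, hk⟩ | ⟨h0, hτ⟩
  · exact key a k hk h1 h2
  · obtain ⟨u, hu, hray⟩ := exists_seq_ray_tendsto m hτ
    have hk : Continuous fun b : ℝ × ℝ => fanKernel m b ‖w‖ :=
      (continuous_fanKernel m).comp (by fun_prop : Continuous fun b : ℝ × ℝ => (b, ‖w‖))
    have ha' : a = (0, a.2) := Prod.ext h0 rfl
    have hlim : Tendsto (fun k => √(a.2 * ‖w‖ ^ 2 / 4) * fanKernel m (u k) ‖w‖ ^ 2) atTop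
        (nhds (√(a.2 * ‖w‖ ^ 2 / 4) * fanKernel m a ‖w‖ ^ 2)) := by
      have hu' : Tendsto u atTop (nhds a) := by
        rw [ha']
        exact hu
      exact (((hk.tendsto _).comp hu').pow 2).const_mul _
    have hev : ∀ᶠ k in atTop, (u k).1 ^ 2 * ‖w‖ ^ 2 < 2 * a.2 := by
      have hc : Continuous fun b : ℝ × ℝ => b.1 ^ 2 * ‖w‖ ^ 2 := by fun_prop
      refine ((hc.tendsto _).comp hu).eventually_lt_const ?_
      rw [h0] at h2
      exact h2
    refine le_of_tendsto hlim ?_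
    filter_upwards [hev] with k hk2
    obtain ⟨e1, e2⟩ := hray k
    rw [← e1] at h1 hk2 ⊢
    exact key (u k) k e2 h1 hk2

lemma norm_fLam_le (n : ℕ) (f : Hn n → ℂ) (lam : ℝ) (v : Cn n) :
    ‖fLam n f lam v‖ ≤ ∫ t : ℝ, ‖f (v, t)‖ := by
  refine (norm_integral_le_integral_norm _).trans_eq (integral_congr_ae (.of_forall fun t => ?_))
  have : I * (lam : ℂ) * (t : ℂ) = ((lam * t : ℝ) : ℂ) * I := by push_cast; ring
  simp only [norm_mul, this, Complex.norm_exp_ofReal_mul_I, one_mul]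

lemma integrable_exp_mul {n : ℕ} {f : Hn n → ℂ} (hf : Integrable f) (lam : ℝ) :
    Integrable fun x : Hn n => cexp (I * (lam : ℂ) * (x.2 : ℂ)) * f x := by
  refine hf.bdd_mul (c := 1) (Continuous.aestronglyMeasurable (by fun_prop)) (.of_forall fun x => ?_)
  have : I * (lam : ℂ) * (x.2 : ℂ) = ((lam * x.2 : ℝ) : ℂ) * I := by push_cast; ring
  rw [this, Complex.norm_exp_ofReal_mul_I]

lemma integrable_fLam {n : ℕ} {f : Hn n → ℂ} (hf : Integrable f) (lam : ℝ) :
    Integrable (fLam n f lam) :=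
  (integrable_exp_mul hf lam).integral_prod_left

lemma continuous_fLam_apply {n : ℕ} {f : Hn n → ℂ} {v : Cn n}
    (hv : Integrable fun t : ℝ => f (v, t)) : Continuous fun lam : ℝ => fLam n f lam v := by
  refine continuous_of_dominated (bound := fun t => ‖f (v, t)‖) (fun lam => ?_) (fun lam => ?_)
    hv.norm (.of_forall fun t => by fun_prop)
  · exact (Continuous.aestronglyMeasurable (by fun_prop)).mul hv.aestronglyMeasurable
  · refine .of_forall fun t => ?_
    have : I * (lam : ℂ) * (t : ℂ) = ((lam * t : ℝ) : ℂ) * I := by push_cast; ring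
    simp only [norm_mul, this, Complex.norm_exp_ofReal_mul_I, one_mul, le_refl]

lemma exists_norm_fLam_le {n : ℕ} (f : Hn n → ℂ) (v : Cn n) {ε : ℝ} (hε : 0 < ε) :
    ∃ M : ℝ, ∀ lam : ℝ, M < |lam| → ‖fLam n f lam v‖ < ε := by
  have h := Real.tendsto_integral_exp_smul_cocompact fun t : ℝ => f (v, t)
  have h2 : Tendsto (fun lam : ℝ => -(2 * π)⁻¹ * lam) (cocompact ℝ) (cocompact ℝ) :=
    (Homeomorph.mulLeft₀ (-(2 * π)⁻¹) (by simp [Real.pi_ne_zero])).isClosedEmbedding.tendsto_cocompact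
  have h3 := (h.comp h2).norm
  rw [norm_zero] at h3
  have h4 := h3.eventually (gt_mem_nhds hε)
  rw [← Metric.cobounded_eq_cocompact, ← comap_norm_atTop] at h4
  obtain ⟨s, hs, hs2⟩ := h4
  obtain ⟨M, hM⟩ := mem_atTop_sets.1 hs
  refine ⟨M, fun lam hlam => ?_⟩
  have h5 := hs2 (hM _ hlam.le : ‖lam‖ ∈ s)
  refine lt_of_eq_of_lt (congrArg norm ?_) h5
  refine integral_congr_ae (.of_forall fun t => ?_)
  simp only [Real.fourierChar_apply, Circle.smul_def, smul_eq_mul]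
  congr 2
  push_cast
  have : (π : ℂ) ≠ 0 := by exact_mod_cast Real.pi_ne_zero
  field_simp

lemma exists_abs_fanKernel_le {m : ℕ} {w : Cn (m + 1)} (hw : w ≠ 0) (M : ℝ) {δ : ℝ} (hδ : 0 < δ) :
    ∃ T : ℝ, ∀ a ∈ fan (m + 1), |a.1| ≤ M → T ≤ a.2 → |fanKernel m a ‖w‖| ≤ δ := by
  have hr : 0 < ‖w‖ ^ 2 := by positivity
  set C : ℝ := 4 + (m + 1) / 2 with hC
  refine ⟨max (4 / ‖w‖ ^ 2) (max (M ^ 2 * ‖w‖ ^ 2 / 2 + 1) (4 * (C / δ ^ 2) ^ 2 / ‖w‖ ^ 2)),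
    fun a ha hM hT => ?_⟩
  simp only [max_le_iff] at hT
  obtain ⟨hT1, hT2, hT3⟩ := hT
  rw [div_le_iff₀ hr] at hT1 hT3
  have hsq : a.1 ^ 2 ≤ M ^ 2 := sq_le_sq' (by linarith [neg_abs_le a.1]) ((le_abs_self _).trans hM)
  have h := sqrt_mul_fanKernel_sq_le ha w hT1 (by nlinarith)
  have hs : C / δ ^ 2 ≤ √(a.2 * ‖w‖ ^ 2 / 4) := Real.le_sqrt_of_sq_le (by linarith)
  have hCpos : 0 < C := by positivity
  have h6 : C / δ ^ 2 * fanKernel m a ‖w‖ ^ 2 ≤ C :=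
    (mul_le_mul_of_nonneg_right hs (sq_nonneg _)).trans h
  rw [div_mul_eq_mul_div, div_le_iff₀ (by positivity)] at h6
  exact abs_le_of_sq_le_sq (le_of_mul_le_mul_left h6 hCpos) hδ.le

/-- The integrand of the normalized Strichartz Fourier transform at the point `a` of the fan. -/
def fanIntegrand (m : ℕ) (f : Hn (m + 1) → ℂ) (z : Cn (m + 1)) (a : ℝ × ℝ) (w : Cn (m + 1)) : ℂ :=
  fLam (m + 1) f (-a.1) (z - w) * (fanKernel m a ‖w‖ : ℂ) *
    cexp (I / 2 * ((-a.1 : ℝ) : ℂ) * (imZW z w : ℂ))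

lemma striNorm_eq_integral_fanIntegrand {m : ℕ} (f : Hn (m + 1) → ℂ) (z : Cn (m + 1)) {a : ℝ × ℝ}
    (ha : a ∈ fan (m + 1)) : striNorm (m + 1) f z a = ∫ w, fanIntegrand m f z a w := by
  by_cases h0 : a.1 = 0
  · have h2 : 0 ≤ a.2 := by
      rcases mem_fan_succ ha with ⟨k, hk⟩ | h
      · rw [hk]; positivity
      · exact h.2
    obtain ⟨x, τ⟩ := a
    obtain rfl : x = 0 := h0
    simp only [striNorm, if_true, striLim, fanIntegrand, fanKernel_zero_left m h2]
    rw [← integral_const_mul]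
    refine integral_congr_ae (.of_forall fun w => ?_)
    simp
    ring
  · have hex : ∃ k : ℕ, a.2 = (2 * k + ((m + 1 : ℕ) : ℝ)) * |a.1| := by
      rcases ha with ⟨k, -, hk⟩ | h
      · exact ⟨k, hk⟩
      · exact absurd h.1 h0
    have hk : a.2 = (2 * fanK (m + 1) a + (m + 1)) * |a.1| := by
      have := hex.choose_spec
      rw [fanK, dif_pos hex]
      push_cast at this ⊢
      exact this
    rw [striNorm, if_neg h0, stri, twConv, ← integral_const_mul]
    refine integral_congr_ae (.of_forall fun w => ?_)
    simp only [fanIntegrand, fanKernel_eq_normC_mul_lagFun m _ hk w]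
    push_cast
    ring

lemma continuous_imZW {n : ℕ} (z : Cn n) : Continuous (imZW z) := by
  unfold imZW
  fun_prop

lemma aestronglyMeasurable_fanIntegrand {m : ℕ} {f : Hn (m + 1) → ℂ} (hf : Integrable f)
    (z : Cn (m + 1)) (a : ℝ × ℝ) : AEStronglyMeasurable (fanIntegrand m f z a) := by
  have h1 : Continuous fun w : Cn (m + 1) => fanKernel m a ‖w‖ :=
    (continuous_fanKernel m).comp (by fun_prop : Continuous fun w : Cn (m + 1) => (a, ‖w‖))
  have h2 := continuous_imZW z
  refine AEStronglyMeasurable.mul (AEStronglyMeasurable.mul ?_ ?_) ?_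
  · exact ((integrable_fLam hf _).comp_sub_left z).aestronglyMeasurable
  · exact (Complex.continuous_ofReal.comp h1).aestronglyMeasurable
  · exact Continuous.aestronglyMeasurable (by fun_prop)

lemma norm_fanIntegrand {m : ℕ} (f : Hn (m + 1) → ℂ) (z : Cn (m + 1)) (a : ℝ × ℝ)
    (w : Cn (m + 1)) : ‖fanIntegrand m f z a w‖ =
      ‖fLam (m + 1) f (-a.1) (z - w)‖ * |fanKernel m a ‖w‖| := by
  have : I / 2 * ((-a.1 : ℝ) : ℂ) * (imZW z w : ℂ) = ((-a.1 * imZW z w / 2 : ℝ) : ℂ) * I := by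
    push_cast; ring
  rw [fanIntegrand, this, norm_mul, Complex.norm_exp_ofReal_mul_I, mul_one, norm_mul,
    Complex.norm_real, Real.norm_eq_abs]

lemma norm_fanIntegrand_le {m : ℕ} (f : Hn (m + 1) → ℂ) (z : Cn (m + 1)) {a : ℝ × ℝ}
    (ha : a ∈ fan (m + 1)) (w : Cn (m + 1)) :
    ‖fanIntegrand m f z a w‖ ≤ ∫ t : ℝ, ‖f (z - w, t)‖ := by
  rw [norm_fanIntegrand]
  calc _ ≤ ‖fLam (m + 1) f (-a.1) (z - w)‖ * 1 := by
        gcongr; exact abs_fanKernel_le_one ha w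
    _ ≤ _ := by rw [mul_one]; exact norm_fLam_le _ f _ _

lemma integrable_integral_norm_sub {n : ℕ} {f : Hn n → ℂ} (hf : Integrable f) (z : Cn n) :
    Integrable fun w : Cn n => ∫ t : ℝ, ‖f (z - w, t)‖ :=
  (Integrable.integral_norm_prod_left hf).comp_sub_left z

lemma ae_integrable_sub {n : ℕ} {f : Hn n → ℂ} (hf : Integrable f) (z : Cn n) :
    ∀ᵐ w : Cn n, Integrable fun t : ℝ => f (z - w, t) :=
  (quasiMeasurePreserving_sub_left volume z).ae
    (Integrable.prod_right_ae hf)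

lemma isClosed_fan {n : ℕ} : IsClosed (fan n) := by
  rw [← isSeqClosed_iff_isClosed]
  intro u a hu hua
  have h1 : Tendsto (fun j => (u j).1) atTop (nhds a.1) := (continuous_fst.tendsto a).comp hua
  have h2 : Tendsto (fun j => (u j).2) atTop (nhds a.2) := (continuous_snd.tendsto a).comp hua
  by_cases h0 : a.1 = 0
  · refine Or.inr ⟨h0, ge_of_tendsto' h2 fun j => ?_⟩
    rcases hu j with ⟨k, -, hk⟩ | h
    · rw [hk]; positivity
    · exact h.2
  · have hq : Tendsto (fun j => ((u j).2 / |(u j).1| - n) / 2) atTop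
        (nhds ((a.2 / |a.1| - n) / 2)) :=
      ((h2.div h1.abs (abs_ne_zero.2 h0)).sub_const _).div_const _
    have hmem : (a.2 / |a.1| - n) / 2 ∈ Set.range ((↑) : ℕ → ℝ) := by
      refine Nat.isClosedEmbedding_coe_real.isClosed_range.mem_of_tendsto hq ?_
      filter_upwards [h1.eventually_ne h0] with j hj
      rcases hu j with ⟨k, -, hk⟩ | h
      · refine ⟨k, ?_⟩
        have := abs_ne_zero.2 hj
        rw [hk]
        field_simp
        ring
      · exact absurd h.1 hj
    obtain ⟨k, hk⟩ := hmem
    refine Or.inl ⟨k, h0, ?_⟩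
    have := abs_ne_zero.2 h0
    rw [hk]
    field_simp
    ring

lemma tendsto_fanIntegrand {m : ℕ} (f : Hn (m + 1) → ℂ) (z : Cn (m + 1)) {w : Cn (m + 1)}
    (hw : w ≠ 0) :
    Tendsto (fun a : fan (m + 1) => fanIntegrand m f z a w)
      (comap Subtype.val (cocompact (ℝ × ℝ))) (nhds 0) := by
  rw [Metric.tendsto_nhds]
  intro ε hε
  obtain ⟨M, hM⟩ := exists_norm_fLam_le f (z - w) hε
  set B := ∫ t : ℝ, ‖f (z - w, t)‖ with hB
  have hB0 : 0 ≤ B := integral_nonneg fun t => norm_nonneg _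
  obtain ⟨T, hT⟩ := exists_abs_fanKernel_le hw M (δ := ε / (B + 1)) (by positivity)
  refine eventually_comap.2 ?_
  have hcpt : IsCompact (Set.Icc (-M) M ×ˢ Set.Icc (0 : ℝ) T) := isCompact_Icc.prod isCompact_Icc
  filter_upwards [hcpt.compl_mem_cocompact] with b hb a hab
  subst hab
  have h2 : 0 ≤ (a : ℝ × ℝ).2 := by
    rcases mem_fan_succ a.2 with ⟨k, hk⟩ | h
    · rw [hk]; positivity
    · exact h.2
  rw [dist_zero_right, norm_fanIntegrand]
  rcases lt_or_ge M |(a : ℝ × ℝ).1| with h | h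
  · calc _ ≤ ‖fLam (m + 1) f (-(a : ℝ × ℝ).1) (z - w)‖ * 1 := by
          gcongr; exact abs_fanKernel_le_one a.2 w
      _ < ε := by rw [mul_one]; exact hM _ (by rwa [abs_neg])
  · have hTa : T ≤ (a : ℝ × ℝ).2 := by
      by_contra! hlt
      exact hb ⟨abs_le.1 h, h2, hlt.le⟩
    calc _ ≤ B * (ε / (B + 1)) := by
          gcongr
          · exact norm_fLam_le _ f _ _
          · exact hT _ a.2 h hTa
      _ < ε := by
          rw [mul_div_assoc', div_lt_iff₀ (by positivity)]
          linarith

/-- **Riemann–Lebesgue lemma, continuity part.**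
For every f ∈ L¹(ℍⁿ) and every fixed z ∈ ℂⁿ, the normalized Strichartz Fourier transform
a ↦ f̃(a,z) is uniformly continuous on the Heisenberg fan Ω ⊆ ℝ². -/
theorem strichartz_uniformContinuousOn (n : ℕ) (hn : 1 ≤ n)
    (f : Hn n → ℂ) (hf : Integrable f (volume : Measure (Hn n))) (z : Cn n) :
    UniformContinuousOn (striNorm n f z) (fan n) := by
  obtain ⟨m, rfl⟩ : ∃ m, n = m + 1 := ⟨n - 1, by omega⟩
  have heq : (fan (m + 1)).domRestrict (striNorm (m + 1) f z) =
      fun a : fan (m + 1) => ∫ w, fanIntegrand m f z a w :=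
    funext fun a => striNorm_eq_integral_fanIntegrand f z a.2
  rw [uniformContinuousOn_iff_restrict, heq]
  refine Continuous.uniformContinuous_of_tendsto_cocompact (x := 0) ?_ ?_
  · refine continuous_of_dominated (fun a => aestronglyMeasurable_fanIntegrand hf z a)
      (fun a => .of_forall fun w => norm_fanIntegrand_le f z a.2 w)
      (integrable_integral_norm_sub hf z) ?_
    filter_upwards [ae_integrable_sub hf z] with w hw
    have h1 : Continuous fun a : fan (m + 1) => fLam (m + 1) f (-(a : ℝ × ℝ).1) (z - w) :=
      (continuous_fLam_apply hw).comp
        (by fun_prop : Continuous fun a : fan (m + 1) => -(a : ℝ × ℝ).1)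
    have h2 : Continuous fun a : fan (m + 1) => fanKernel m a ‖w‖ :=
      (continuous_fanKernel m).comp
        (by fun_prop : Continuous fun a : fan (m + 1) => ((a : ℝ × ℝ), ‖w‖))
    unfold fanIntegrand
    fun_prop
  · have hlim : Tendsto (fun a : fan (m + 1) => ∫ w, fanIntegrand m f z a w)
        (comap Subtype.val (cocompact (ℝ × ℝ))) (nhds (∫ _ : Cn (m + 1), (0 : ℂ))) := by
      have : (cocompact (ℝ × ℝ)).IsCountablyGenerated := by
        rw [← Metric.cobounded_eq_cocompact, ← comap_norm_atTop]
        infer_instance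
      refine tendsto_integral_filter_of_dominated_convergence _
        (.of_forall fun a => aestronglyMeasurable_fanIntegrand hf z a)
        (.of_forall fun a => .of_forall fun w => norm_fanIntegrand_le f z a.2 w)
        (integrable_integral_norm_sub hf z) ?_
      filter_upwards [Measure.ae_ne volume (0 : Cn (m + 1))] with w hw
      exact tendsto_fanIntegrand f z hw
    rw [integral_zero] at hlim
    exact hlim.mono_left
      (tendsto_iff_comap.1 isClosed_fan.isClosedEmbedding_subtypeVal.tendsto_cocompact)
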